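/- arXiv:0704.1541 — 3 statements merged into one kernel-verified Lean document; each statement's English description precedes it below -/
import Mathlib

section
/- For every integer n ≥ 1, the dimensions of the graded components of so(4n) are dim g_e = n(2n+1) and dim g_a = dim g_b = dim g_c = n(2n−1). -/
open Matrix Kronecker

noncomputable section

def Ja4 : Matrix (Fin 4) (Fin 4) ℝ :=
  !![0,-1,0,0; 1,0,0,0; 0,0,0,1; 0,0,-1,0]

def Jb4 : Matrix (Fin 4) (Fin 4) ℝ :=
  !![0,0,0,1; 0,0,-1,0; 0,1,0,0; -1,0,0,0]

/-- `J_a = [[0,−I_n,0,0],[I_n,0,0,0],[0,0,0,I_n],[0,0,−I_n,0]]` in n×n block form. -/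
def Ja (n : ℕ) : Matrix (Fin 4 × Fin n) (Fin 4 × Fin n) ℝ :=
  Ja4 ⊗ₖ (1 : Matrix (Fin n) (Fin n) ℝ)

/-- `J_b = [[0,0,0,I_n],[0,0,−I_n,0],[0,I_n,0,0],[−I_n,0,0,0]]` in n×n block form. -/
def Jb (n : ℕ) : Matrix (Fin 4 × Fin n) (Fin 4 × Fin n) ℝ :=
  Jb4 ⊗ₖ (1 : Matrix (Fin n) (Fin n) ℝ)

def tauA (n : ℕ) (M : Matrix (Fin 4 × Fin n) (Fin 4 × Fin n) ℝ) :
    Matrix (Fin 4 × Fin n) (Fin 4 × Fin n) ℝ :=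
  (Ja n)⁻¹ * M * Ja n

def tauB (n : ℕ) (M : Matrix (Fin 4 × Fin n) (Fin 4 × Fin n) ℝ) :
    Matrix (Fin 4 × Fin n) (Fin 4 × Fin n) ℝ :=
  (Jb n)⁻¹ * M * Jb n

def gE (n : ℕ) : Set (Matrix (Fin 4 × Fin n) (Fin 4 × Fin n) ℝ) :=
  {M | Mᵀ = -M ∧ tauA n M = M ∧ tauB n M = M}

def gA (n : ℕ) : Set (Matrix (Fin 4 × Fin n) (Fin 4 × Fin n) ℝ) :=
  {M | Mᵀ = -M ∧ tauA n M = M ∧ tauB n M = -M}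

def gB (n : ℕ) : Set (Matrix (Fin 4 × Fin n) (Fin 4 × Fin n) ℝ) :=
  {M | Mᵀ = -M ∧ tauA n M = -M ∧ tauB n M = M}

def gC (n : ℕ) : Set (Matrix (Fin 4 × Fin n) (Fin 4 × Fin n) ℝ) :=
  {M | Mᵀ = -M ∧ tauA n M = -M ∧ tauB n M = -M}

/-- The matrices `A` with `Aᵀ = s • A`: symmetric for `s = 1`, skew-symmetric for `s = -1`. -/
def signedSymm (n : ℕ) (s : ℝ) : Submodule ℝ (Matrix (Fin n) (Fin n) ℝ) where
  carrier := {A | Aᵀ = s • A}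
  zero_mem' := by simp
  add_mem' := fun {A B} hA hB => by
    simp only [Set.mem_ofPred_eq] at *
    rw [transpose_add, hA, hB, smul_add]
  smul_mem' := fun c A hA => by
    simp only [Set.mem_ofPred_eq] at *
    rw [transpose_smul, hA, smul_comm]

theorem mem_signedSymm {n : ℕ} {s : ℝ} {A : Matrix (Fin n) (Fin n) ℝ} :
    A ∈ signedSymm n s ↔ Aᵀ = s • A := Iff.rfl

/-- Symmetric matrices are functions on unordered pairs of indices. -/
def signedSymmOneEquiv (n : ℕ) : signedSymm n 1 ≃ₗ[ℝ] (Sym2 (Fin n) → ℝ) where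
  toFun A := Sym2.lift ⟨fun i j => A.1 i j, fun i j => by
    have h := congrFun (congrFun (mem_signedSymm.1 A.2) j) i
    simpa using h⟩
  map_add' A B := by
    ext z; induction z with | _ i j => rfl
  map_smul' c A := by
    ext z; induction z with | _ i j => rfl
  invFun f := ⟨of fun i j => f s(i, j), by
    rw [mem_signedSymm, one_smul]
    ext i j
    simp [Sym2.eq_swap]⟩
  left_inv A := by ext i j; rfl
  right_inv f := by
    ext z; induction z with | _ i j => rfl

theorem two_mul_finrank_signedSymm_one (n : ℕ) :
    2 * Module.finrank ℝ (signedSymm n 1) = n * (n + 1) := by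
  rw [(signedSymmOneEquiv n).finrank_eq, Module.finrank_fintype_fun_eq_card, Sym2.card,
    Fintype.card_fin, Nat.choose_two_right, Nat.add_sub_cancel,
    Nat.mul_div_cancel' (by simpa [mul_comm] using (Nat.even_mul_succ_self n).two_dvd), mul_comm]

theorem isCompl_signedSymm (n : ℕ) : IsCompl (signedSymm n 1) (signedSymm n (-1)) := by
  rw [isCompl_iff, Submodule.disjoint_def,
    Submodule.codisjoint_iff_exists_add_eq]
  refine ⟨fun A h₁ h₂ => ?_, fun A => ?_⟩
  · rw [mem_signedSymm, one_smul] at h₁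
    rw [mem_signedSymm, h₁, neg_one_smul] at h₂
    ext i j
    exact self_eq_neg.1 (congrFun (congrFun h₂ i) j)
  · refine ⟨(1 / 2 : ℝ) • (A + Aᵀ), (1 / 2 : ℝ) • (A - Aᵀ), ?_, ?_, ?_⟩
    · rw [mem_signedSymm]
      ext i j
      simp [add_comm]
    · rw [mem_signedSymm]
      ext i j
      simp
      ring
    · ext i j
      simp
      ring

theorem finrank_signedSymm_add (n : ℕ) :
    Module.finrank ℝ (signedSymm n 1) + Module.finrank ℝ (signedSymm n (-1)) = n * n := by
  rw [Submodule.finrank_add_eq_of_isCompl (isCompl_signedSymm n), Module.finrank_matrix]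
  simp

theorem Ja_mul_self (n : ℕ) : Ja n * Ja n = -1 := by
  have h : Ja4 * Ja4 = (-1 : ℝ) • (1 : Matrix (Fin 4) (Fin 4) ℝ) := by
    ext i j
    fin_cases i <;> fin_cases j <;> simp [Ja4, Matrix.mul_apply, Fin.sum_univ_four]
  rw [Ja, ← mul_kronecker_mul, h, mul_one, smul_kronecker, one_kronecker_one, neg_one_smul]

theorem Jb_mul_self (n : ℕ) : Jb n * Jb n = -1 := by
  have h : Jb4 * Jb4 = (-1 : ℝ) • (1 : Matrix (Fin 4) (Fin 4) ℝ) := by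
    ext i j
    fin_cases i <;> fin_cases j <;> simp [Jb4, Matrix.mul_apply, Fin.sum_univ_four]
  rw [Jb, ← mul_kronecker_mul, h, mul_one, smul_kronecker, one_kronecker_one, neg_one_smul]

theorem inv_mul_mul_eq_iff {m : Type*} [Fintype m] [DecidableEq m] {J M N : Matrix m m ℝ}
    (hJ : J * J = -1) : J⁻¹ * M * J = N ↔ M * J = J * N := by
  have h : J⁻¹ = -J := inv_eq_left_inv (by rw [neg_mul, hJ, neg_neg])
  have hc : -J * J = 1 := by rw [neg_mul, hJ, neg_neg]
  have hc' : J * -J = 1 := by rw [mul_neg, hJ, neg_neg]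
  rw [h, mul_assoc]
  constructor
  · rintro rfl
    rw [← mul_assoc, hc', one_mul]
  · intro h
    rw [h, ← mul_assoc, hc, one_mul]

/-- The skew-symmetric matrices that are eigenvectors of `tauA` and `tauB` with eigenvalues
`ε` and `δ`. -/
def gradedPart (n : ℕ) (ε δ : ℝ) : Submodule ℝ (Matrix (Fin 4 × Fin n) (Fin 4 × Fin n) ℝ) where
  carrier := {M | Mᵀ = -M ∧ M * Ja n = ε • (Ja n * M) ∧ M * Jb n = δ • (Jb n * M)}
  zero_mem' := by simp
  add_mem' := fun {A B} hA hB => by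
    simp only [Set.mem_ofPred_eq] at *
    simp only [transpose_add, add_mul, mul_add, smul_add, hA.1, hA.2.1, hA.2.2, hB.1, hB.2.1,
      hB.2.2, neg_add, and_self]
  smul_mem' := fun c A hA => by
    simp only [Set.mem_ofPred_eq] at *
    simp only [transpose_smul, Matrix.smul_mul, Matrix.mul_smul, hA.1, hA.2.1, hA.2.2, smul_neg,
      smul_comm c, and_self]

theorem mem_gradedPart {n : ℕ} {ε δ : ℝ} {M : Matrix (Fin 4 × Fin n) (Fin 4 × Fin n) ℝ} :
    M ∈ gradedPart n ε δ ↔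
      Mᵀ = -M ∧ M * Ja n = ε • (Ja n * M) ∧ M * Jb n = δ • (Jb n * M) := Iff.rfl

/-- The `4 × 4` matrix with first row the `k`-th basis vector that satisfies
`L * Ja4 = ε • (Ja4 * L)` and `L * Jb4 = δ • (Jb4 * L)`. -/
def blockBasis (ε δ : ℝ) (k : Fin 4) : Matrix (Fin 4) (Fin 4) ℝ :=
  of ![Pi.single k 1, -ε • (Pi.single k 1 ᵥ* Ja4), -(ε * δ) • (Pi.single k 1 ᵥ* (Jb4 * Ja4)),
    δ • (Pi.single k 1 ᵥ* Jb4)]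

theorem blockBasis_mul_Ja4 {ε δ : ℝ} (hε : ε * ε = 1) (k : Fin 4) :
    blockBasis ε δ k * Ja4 = ε • (Ja4 * blockBasis ε δ k) := by
  ext i j
  fin_cases k <;> fin_cases i <;> fin_cases j <;>
    simp [blockBasis, Ja4, Jb4, Matrix.mul_apply, Fin.sum_univ_four] <;> grind

theorem blockBasis_mul_Jb4 {ε δ : ℝ} (hδ : δ * δ = 1) (k : Fin 4) :
    blockBasis ε δ k * Jb4 = δ • (Jb4 * blockBasis ε δ k) := by
  ext i j
  fin_cases k <;> fin_cases i <;> fin_cases j <;>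
    simp [blockBasis, Ja4, Jb4, Matrix.mul_apply, Fin.sum_univ_four] <;> grind

/-- The block matrix with prescribed first block row that is an eigenvector of `tauA`
and `tauB`. -/
def ofFirstRow (n : ℕ) (ε δ : ℝ) (A : Fin 4 → Matrix (Fin n) (Fin n) ℝ) :
    Matrix (Fin 4 × Fin n) (Fin 4 × Fin n) ℝ :=
  ∑ k, blockBasis ε δ k ⊗ₖ A k

theorem ofFirstRow_apply_zero {n : ℕ} {ε δ : ℝ} (A : Fin 4 → Matrix (Fin n) (Fin n) ℝ)
    (k : Fin 4) (p q : Fin n) : ofFirstRow n ε δ A (0, p) (k, q) = A k p q := by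
  simp [ofFirstRow, Matrix.sum_apply, blockBasis, Pi.single_apply]

theorem ofFirstRow_mul_Ja {n : ℕ} {ε δ : ℝ} (hε : ε * ε = 1)
    (A : Fin 4 → Matrix (Fin n) (Fin n) ℝ) :
    ofFirstRow n ε δ A * Ja n = ε • (Ja n * ofFirstRow n ε δ A) := by
  simp only [ofFirstRow, Ja, Finset.sum_mul, Finset.mul_sum, Finset.smul_sum,
    ← mul_kronecker_mul, blockBasis_mul_Ja4 hε, smul_kronecker, mul_one, one_mul]

theorem ofFirstRow_mul_Jb {n : ℕ} {ε δ : ℝ} (hδ : δ * δ = 1)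
    (A : Fin 4 → Matrix (Fin n) (Fin n) ℝ) :
    ofFirstRow n ε δ A * Jb n = δ • (Jb n * ofFirstRow n ε δ A) := by
  simp only [ofFirstRow, Jb, Finset.sum_mul, Finset.mul_sum, Finset.smul_sum,
    ← mul_kronecker_mul, blockBasis_mul_Jb4 hδ, smul_kronecker, mul_one, one_mul]

theorem Ja_mul_apply {n : ℕ} (M : Matrix (Fin 4 × Fin n) (Fin 4 × Fin n) ℝ) (i : Fin 4)
    (p : Fin n) (x : Fin 4 × Fin n) : (Ja n * M) (i, p) x = ∑ j, Ja4 i j * M (j, p) x := by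
  simp [Ja, Matrix.mul_apply, Fintype.sum_prod_type, Matrix.one_apply]

theorem Jb_mul_apply {n : ℕ} (M : Matrix (Fin 4 × Fin n) (Fin 4 × Fin n) ℝ) (i : Fin 4)
    (p : Fin n) (x : Fin 4 × Fin n) : (Jb n * M) (i, p) x = ∑ j, Jb4 i j * M (j, p) x := by
  simp [Jb, Matrix.mul_apply, Fintype.sum_prod_type, Matrix.one_apply]

theorem eq_zero_of_firstRow_eq_zero {n : ℕ} {ε δ : ℝ} (hε : ε * ε = 1) (hδ : δ * δ = 1)
    {M : Matrix (Fin 4 × Fin n) (Fin 4 × Fin n) ℝ} (ha : M * Ja n = ε • (Ja n * M))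
    (hb : M * Jb n = δ • (Jb n * M)) (h : ∀ p x, M (0, p) x = 0) : M = 0 := by
  have hε₀ : ε ≠ 0 := left_ne_zero_of_mul_eq_one hε
  have hδ₀ : δ ≠ 0 := left_ne_zero_of_mul_eq_one hδ
  have ha_row : ∀ i p, (∀ x, M (i, p) x = 0) → ∀ x, ∑ j, Ja4 i j * M (j, p) x = 0 := by
    intro i p hi x
    have := congrFun (congrFun ha (i, p)) x
    rw [Matrix.mul_apply, Matrix.smul_apply, Ja_mul_apply] at this
    simpa [hi, hε₀] using this.symm
  have hb_row : ∀ i p, (∀ x, M (i, p) x = 0) → ∀ x, ∑ j, Jb4 i j * M (j, p) x = 0 := by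
    intro i p hi x
    have := congrFun (congrFun hb (i, p)) x
    rw [Matrix.mul_apply, Matrix.smul_apply, Jb_mul_apply] at this
    simpa [hi, hδ₀] using this.symm
  have h₁ : ∀ p x, M (1, p) x = 0 := fun p x => by
    simpa [Ja4, Fin.sum_univ_four] using ha_row 0 p (h p) x
  have h₃ : ∀ p x, M (3, p) x = 0 := fun p x => by
    simpa [Jb4, Fin.sum_univ_four] using hb_row 0 p (h p) x
  have h₂ : ∀ p x, M (2, p) x = 0 := fun p x => by
    simpa [Ja4, Fin.sum_univ_four] using ha_row 3 p (h₃ p) x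
  ext ⟨i, p⟩ x
  fin_cases i
  exacts [h p x, h₁ p x, h₂ p x, h₃ p x]

theorem eq_ofFirstRow {n : ℕ} {ε δ : ℝ} (hε : ε * ε = 1) (hδ : δ * δ = 1)
    {M : Matrix (Fin 4 × Fin n) (Fin 4 × Fin n) ℝ} (ha : M * Ja n = ε • (Ja n * M))
    (hb : M * Jb n = δ • (Jb n * M)) :
    ofFirstRow n ε δ (fun k => of fun p q => M (0, p) (k, q)) = M := by
  rw [← sub_eq_zero]
  refine eq_zero_of_firstRow_eq_zero hε hδ ?_ ?_ ?_
  · rw [sub_mul, mul_sub, smul_sub, ha, ofFirstRow_mul_Ja hε]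
  · rw [sub_mul, mul_sub, smul_sub, hb, ofFirstRow_mul_Jb hδ]
  · rintro p ⟨k, q⟩
    rw [Matrix.sub_apply, ofFirstRow_apply_zero, of_apply, sub_self]

theorem transpose_ofFirstRow {n : ℕ} {ε δ : ℝ} {σ : Fin 4 → ℝ}
    (hσ : ∀ k, (blockBasis ε δ k)ᵀ = -σ k • blockBasis ε δ k)
    (A : Fin 4 → Matrix (Fin n) (Fin n) ℝ) :
    (ofFirstRow n ε δ A)ᵀ = -ofFirstRow n ε δ (fun k => σ k • (A k)ᵀ) := by
  simp only [ofFirstRow, transpose_sum, ← kroneckerMap_transpose, ← Finset.sum_neg_distrib]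
  refine Finset.sum_congr rfl fun k _ => ?_
  rw [hσ, smul_kronecker, kronecker_smul, neg_smul]

/-- An element of a graded part is determined by its first block row. -/
def firstRowEquiv (n : ℕ) {ε δ : ℝ} (hε : ε * ε = 1) (hδ : δ * δ = 1) {σ : Fin 4 → ℝ}
    (hσ₁ : ∀ k, σ k * σ k = 1)
    (hσ : ∀ k, (blockBasis ε δ k)ᵀ = -σ k • blockBasis ε δ k) :
    gradedPart n ε δ ≃ₗ[ℝ] ((k : Fin 4) → signedSymm n (σ k)) where
  toFun M k := ⟨of fun p q => M.1 (0, p) (k, q), by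
    obtain ⟨M, ht, ha, hb⟩ := M
    rw [← eq_ofFirstRow hε hδ ha hb, transpose_ofFirstRow hσ, neg_inj] at ht
    ext p q
    have h := congrFun (congrFun ht (0, p)) (k, q)
    rw [ofFirstRow_apply_zero, ofFirstRow_apply_zero] at h
    have h' := congrArg (σ k * ·) h
    simpa [← mul_assoc, hσ₁] using h'⟩
  map_add' M N := rfl
  map_smul' c M := rfl
  invFun A := ⟨ofFirstRow n ε δ (fun k => (A k).1), by
    refine ⟨?_, ofFirstRow_mul_Ja hε _, ofFirstRow_mul_Jb hδ _⟩
    rw [transpose_ofFirstRow hσ]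
    congr 2
    ext1 k
    rw [mem_signedSymm.1 (A k).2, smul_smul, hσ₁, one_smul]⟩
  left_inv M := Subtype.ext (eq_ofFirstRow hε hδ M.2.2.1 M.2.2.2)
  right_inv A := by
    ext k p q
    exact ofFirstRow_apply_zero (fun k => (A k).1) k p q

theorem finrank_gradedPart (n : ℕ) {ε δ : ℝ} (hε : ε * ε = 1) (hδ : δ * δ = 1) {σ : Fin 4 → ℝ}
    (hσ₁ : ∀ k, σ k * σ k = 1)
    (hσ : ∀ k, (blockBasis ε δ k)ᵀ = -σ k • blockBasis ε δ k) :
    Module.finrank ℝ (gradedPart n ε δ) = ∑ k, Module.finrank ℝ (signedSymm n (σ k)) := by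
  rw [(firstRowEquiv n hε hδ hσ₁ hσ).finrank_eq, Module.finrank_pi_fintype]

theorem gE_eq (n : ℕ) : gE n = gradedPart n 1 1 := by
  ext M
  simp [gE, tauA, tauB, mem_gradedPart, inv_mul_mul_eq_iff, Ja_mul_self, Jb_mul_self]

theorem gA_eq (n : ℕ) : gA n = gradedPart n 1 (-1) := by
  ext M
  simp [gA, tauA, tauB, mem_gradedPart, inv_mul_mul_eq_iff, Ja_mul_self, Jb_mul_self]

theorem gB_eq (n : ℕ) : gB n = gradedPart n (-1) 1 := by
  ext M
  simp [gB, tauA, tauB, mem_gradedPart, inv_mul_mul_eq_iff, Ja_mul_self, Jb_mul_self]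

theorem gC_eq (n : ℕ) : gC n = gradedPart n (-1) (-1) := by
  ext M
  simp [gC, tauA, tauB, mem_gradedPart, inv_mul_mul_eq_iff, Ja_mul_self, Jb_mul_self]

theorem finrank_gradedPart_one_one (n : ℕ) :
    Module.finrank ℝ (gradedPart n 1 1) =
      3 * Module.finrank ℝ (signedSymm n 1) + Module.finrank ℝ (signedSymm n (-1)) := by
  rw [finrank_gradedPart n (σ := ![-1, 1, 1, 1]) (by norm_num) (by norm_num)
    (fun k => by fin_cases k <;> simp)
    (fun k => by
      ext i j
      fin_cases k <;> fin_cases i <;> fin_cases j <;>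
        simp [blockBasis, Ja4, Jb4])]
  rw [Fin.sum_univ_four]
  change Module.finrank ℝ (signedSymm n (-1)) + Module.finrank ℝ (signedSymm n 1) +
    Module.finrank ℝ (signedSymm n 1) + Module.finrank ℝ (signedSymm n 1) = _
  ring

theorem finrank_gradedPart_one_neg_one (n : ℕ) :
    Module.finrank ℝ (gradedPart n 1 (-1)) =
      Module.finrank ℝ (signedSymm n 1) + 3 * Module.finrank ℝ (signedSymm n (-1)) := by
  rw [finrank_gradedPart n (σ := ![-1, 1, -1, -1]) (by norm_num) (by norm_num)
    (fun k => by fin_cases k <;> simp)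
    (fun k => by
      ext i j
      fin_cases k <;> fin_cases i <;> fin_cases j <;>
        simp [blockBasis, Ja4, Jb4])]
  rw [Fin.sum_univ_four]
  change Module.finrank ℝ (signedSymm n (-1)) + Module.finrank ℝ (signedSymm n 1) +
    Module.finrank ℝ (signedSymm n (-1)) + Module.finrank ℝ (signedSymm n (-1)) = _
  ring

theorem finrank_gradedPart_neg_one_one (n : ℕ) :
    Module.finrank ℝ (gradedPart n (-1) 1) =
      Module.finrank ℝ (signedSymm n 1) + 3 * Module.finrank ℝ (signedSymm n (-1)) := by
  rw [finrank_gradedPart n (σ := ![-1, -1, -1, 1]) (by norm_num) (by norm_num)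
    (fun k => by fin_cases k <;> simp)
    (fun k => by
      ext i j
      fin_cases k <;> fin_cases i <;> fin_cases j <;>
        simp [blockBasis, Ja4, Jb4])]
  rw [Fin.sum_univ_four]
  change Module.finrank ℝ (signedSymm n (-1)) + Module.finrank ℝ (signedSymm n (-1)) +
    Module.finrank ℝ (signedSymm n (-1)) + Module.finrank ℝ (signedSymm n 1) = _
  ring

theorem finrank_gradedPart_neg_one_neg_one (n : ℕ) :
    Module.finrank ℝ (gradedPart n (-1) (-1)) =
      Module.finrank ℝ (signedSymm n 1) + 3 * Module.finrank ℝ (signedSymm n (-1)) := by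
  rw [finrank_gradedPart n (σ := ![-1, -1, 1, -1]) (by norm_num) (by norm_num)
    (fun k => by fin_cases k <;> simp)
    (fun k => by
      ext i j
      fin_cases k <;> fin_cases i <;> fin_cases j <;>
        simp [blockBasis, Ja4, Jb4])]
  rw [Fin.sum_univ_four]
  change Module.finrank ℝ (signedSymm n (-1)) + Module.finrank ℝ (signedSymm n (-1)) +
    Module.finrank ℝ (signedSymm n 1) + Module.finrank ℝ (signedSymm n (-1)) = _
  ring

/-- For every `n ≥ 1`, `dim g_e = n(2n+1)` and `dim g_a = dim g_b = dim g_c = n(2n−1)`. -/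
theorem stmt7 (n : ℕ) (hn : 1 ≤ n) :
    Module.finrank ℝ (Submodule.span ℝ (gE n)) = n * (2 * n + 1) ∧
    Module.finrank ℝ (Submodule.span ℝ (gA n)) = n * (2 * n - 1) ∧
    Module.finrank ℝ (Submodule.span ℝ (gB n)) = n * (2 * n - 1) ∧
    Module.finrank ℝ (Submodule.span ℝ (gC n)) = n * (2 * n - 1) := by
  rw [gE_eq, gA_eq, gB_eq, gC_eq]
  rw [Submodule.span_eq, Submodule.span_eq, Submodule.span_eq, Submodule.span_eq,
    finrank_gradedPart_one_one, finrank_gradedPart_one_neg_one, finrank_gradedPart_neg_one_one,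
    finrank_gradedPart_neg_one_neg_one]
  have h₁ := two_mul_finrank_signedSymm_one n
  have h₂ := finrank_signedSymm_add n
  have h₃ : n * (2 * n - 1) + n = 2 * (n * n) := by
    obtain ⟨m, rfl⟩ := Nat.exists_eq_add_of_le' hn
    rw [show 2 * (m + 1) - 1 = 2 * m + 1 by omega]
    ring
  refine ⟨?_, ?_, ?_, ?_⟩ <;> nlinarith
end
end

section
/- Let d > r ≥ 1 be integers and λ₁, λ₂ real numbers. The quadratic form q_{λ₁,λ₂} on ℝ^d is positive definite if and only if λ₁ > 0 and λ₂ > λ₁(r−1)/(2(r+1)). -/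
noncomputable section

/-- The quadratic form `q_{λ₁,λ₂}` on `ℝ^d` (coordinates `u_1,…,u_{d−r}, x_1,…,x_r`):
`q = λ₁·Σ u_j² + λ₂·Σ x_i² + (λ₂ − λ₁/2)·Σ_{i<j} x_i x_j`. -/
def qform (d r : ℕ) (l1 l2 : ℝ) (v : Fin (d - r) ⊕ Fin r → ℝ) : ℝ :=
  l1 * ∑ j : Fin (d - r), v (Sum.inl j) ^ 2 + l2 * ∑ i : Fin r, v (Sum.inr i) ^ 2 +
    (l2 - l1 / 2) * ∑ i : Fin r, ∑ j ∈ Finset.Ioi i, v (Sum.inr i) * v (Sum.inr j)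

/-- Twice the sum of `x i * x j` over `i < j` is `(∑ x)² - ∑ x²`. -/
theorem two_mul_sum_sum_Ioi_mul {ι : Type*} [Fintype ι] [LinearOrder ι] [LocallyFiniteOrderTop ι]
    [LocallyFiniteOrderBot ι] (x : ι → ℝ) :
    2 * ∑ i, ∑ j ∈ Finset.Ioi i, x i * x j = (∑ i, x i) ^ 2 - ∑ i, x i ^ 2 := by
  have h := Finset.sum_sum_Ioi_add_eq_sum_sum_off_diag (fun i j => x i * x j)
  have h_left : 2 * ∑ i, ∑ j ∈ Finset.Ioi i, x i * x j =
      ∑ i, ∑ j ∈ Finset.Ioi i, (x j * x i + x i * x j) := by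
    simp_rw [Finset.mul_sum]
    refine Finset.sum_congr rfl fun i _ => Finset.sum_congr rfl fun j _ => ?_
    ring
  rw [h_left, h, pow_two, Finset.sum_mul_sum, ← Finset.sum_sub_distrib]
  refine Finset.sum_congr rfl fun i _ => ?_
  rw [← Finset.sum_add_sum_compl {i} (fun j => x i * x j), Finset.sum_singleton, pow_two,
    add_sub_cancel_left]
  exact Finset.sum_congr rfl fun j _ => mul_comm _ _

theorem qform_eq (d r : ℕ) (l1 l2 : ℝ) (v : Fin (d - r) ⊕ Fin r → ℝ) :
    qform d r l1 l2 v = l1 * ∑ j, v (Sum.inl j) ^ 2 +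
      ((l2 / 2 + l1 / 4) * ∑ i, v (Sum.inr i) ^ 2 +
        (l2 / 2 - l1 / 4) * (∑ i, v (Sum.inr i)) ^ 2) := by
  have h := two_mul_sum_sum_Ioi_mul fun i => v (Sum.inr i)
  unfold qform
  linear_combination (l2 / 2 - l1 / 4) * h

/-- `q_{λ₁,λ₂}` is positive definite iff `λ₁ > 0` and `λ₂ > λ₁(r−1)/(2(r+1))`. -/
theorem stmt12 (d r : ℕ) (hr : 1 ≤ r) (hrd : r < d) (l1 l2 : ℝ) :
    (∀ v : Fin (d - r) ⊕ Fin r → ℝ, v ≠ 0 → 0 < qform d r l1 l2 v) ↔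
      (0 < l1 ∧ l1 * ((r : ℝ) - 1) / (2 * ((r : ℝ) + 1)) < l2) := by
  have hr1 : (1 : ℝ) ≤ r := by exact_mod_cast hr
  rw [div_lt_iff₀ (by positivity)]
  constructor
  · intro h
    constructor
    · have hu := h (Pi.single (Sum.inl ⟨0, by omega⟩) 1) (by simp)
      rw [qform_eq] at hu
      simpa [Pi.single_apply, Sum.inl.injEq] using hu
    · have hx := h (Sum.elim 0 1) fun h0 => by
        simpa using congrFun h0 (Sum.inr ⟨0, hr⟩)
      rw [qform_eq] at hx
      simp only [Sum.elim_inl, Sum.elim_inr, Pi.zero_apply, Pi.one_apply, one_pow,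
        Finset.sum_const, Finset.card_univ, Fintype.card_fin, nsmul_eq_mul, mul_one, ne_eq,
        OfNat.ofNat_ne_zero, not_false_eq_true, zero_pow, mul_zero, zero_add] at hx
      have hpos : 0 < (r : ℝ) * ((l2 / 2 + l1 / 4) + (l2 / 2 - l1 / 4) * r) := by linarith
      have := pos_of_mul_pos_right hpos (by positivity)
      linarith
  · rintro ⟨h1, h2⟩ v hv
    rw [qform_eq]
    have h_l2 : 0 < l2 := by
      have : 0 ≤ l1 * ((r : ℝ) - 1) := mul_nonneg h1.le (by linarith)
      exact pos_of_mul_pos_left (this.trans_lt h2) (by positivity)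
    have h_cs : (∑ i, v (Sum.inr i)) ^ 2 ≤ r * ∑ i, v (Sum.inr i) ^ 2 := by
      simpa using sq_sum_le_card_mul_sum_sq (s := Finset.univ) (f := fun i => v (Sum.inr i))
    have hU : 0 ≤ ∑ j, v (Sum.inl j) ^ 2 := Finset.sum_nonneg fun _ _ => sq_nonneg _
    have hX : 0 ≤ ∑ i, v (Sum.inr i) ^ 2 := Finset.sum_nonneg fun _ _ => sq_nonneg _
    obtain ⟨m, hm, h_le⟩ : ∃ m : ℝ, 0 < m ∧ m * ∑ i, v (Sum.inr i) ^ 2 ≤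
        (l2 / 2 + l1 / 4) * ∑ i, v (Sum.inr i) ^ 2 +
          (l2 / 2 - l1 / 4) * (∑ i, v (Sum.inr i)) ^ 2 := by
      rcases le_total 0 (l2 / 2 - l1 / 4) with hc | hc
      · exact ⟨l2 / 2 + l1 / 4, by positivity,
          le_add_of_nonneg_right (mul_nonneg hc (sq_nonneg _))⟩
      · refine ⟨(l2 / 2 + l1 / 4) + (l2 / 2 - l1 / 4) * r, by linarith, ?_⟩
        linarith [mul_le_mul_of_nonpos_left h_cs hc]
    refine lt_of_lt_of_le ?_ (add_le_add_right h_le _)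
    obtain ⟨k, hk⟩ := Function.ne_iff.mp hv
    have hk2 : 0 < v k ^ 2 := sq_pos_of_ne_zero hk
    cases k with
    | inl j =>
      have : 0 < ∑ j, v (Sum.inl j) ^ 2 :=
        Finset.sum_pos' (fun _ _ => sq_nonneg _) ⟨j, Finset.mem_univ _, hk2⟩
      positivity
    | inr i =>
      have : 0 < ∑ i, v (Sum.inr i) ^ 2 :=
        Finset.sum_pos' (fun _ _ => sq_nonneg _) ⟨i, Finset.mem_univ _, hk2⟩
      positivity
end
end

section
/- Let d > r ≥ 1 be integers and λ₁ᵃ, λ₂ᵃ, λ₁ᵇ, λ₂ᵇ, λ₁ᶜ, λ₂ᶜ real numbers. The quadratic form B on ℝ^{3d} = ℝ^d × ℝ^d × ℝ^d given as the orthogonal direct sum B(v_a, v_b, v_c) = q_{λ₁ᵃ,λ₂ᵃ}(v_a) + q_{λ₁ᵇ,λ₂ᵇ}(v_b) + q_{λ₁ᶜ,λ₂ᶜ}(v_c) is positive definite if and only if for every γ ∈ {a,b,c} one has λ₁ᵞ > 0 and λ₂ᵞ > λ₁ᵞ(r−1)/(2(r+1)). -/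
noncomputable section

/-- The orthogonal direct sum `B(v_a,v_b,v_c) = q_{λ₁ᵃ,λ₂ᵃ}(v_a) + q_{λ₁ᵇ,λ₂ᵇ}(v_b) +
q_{λ₁ᶜ,λ₂ᶜ}(v_c)` on `ℝ^{3d}`, the index `γ ∈ {a,b,c}` being modelled by `Fin 3`. -/
def Bform (d r : ℕ) (l1 l2 : Fin 3 → ℝ) (v : Fin 3 → (Fin (d - r) ⊕ Fin r → ℝ)) : ℝ :=
  ∑ γ : Fin 3, qform d r (l1 γ) (l2 γ) (v γ)

theorem two_mul_sum_sum_Ioi_mul_add_sum_sq {R : Type*} [CommRing R] {r : ℕ} (x : Fin r → R) :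
    2 * ∑ i, ∑ j ∈ Finset.Ioi i, x i * x j + ∑ i, x i ^ 2 = (∑ i, x i) ^ 2 := by
  have h := Finset.sum_sum_Ioi_add_eq_sum_sum_off_diag (fun i j => x i * x j)
  have h2 : ∀ i, ∑ j ∈ ({i}ᶜ : Finset (Fin r)), x j * x i + x i ^ 2 = (∑ j, x j) * x i := by
    intro i
    rw [Finset.sum_mul, ← Finset.sum_compl_add_sum {i}]
    simp [sq]
  have h3 : ∑ i, ∑ j ∈ Finset.Ioi i, (x j * x i + x i * x j)
      = 2 * ∑ i, ∑ j ∈ Finset.Ioi i, x i * x j := by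
    simp_rw [Finset.mul_sum]
    refine Finset.sum_congr rfl fun i _ => Finset.sum_congr rfl fun j _ => ?_
    ring
  rw [← h3, h, ← Finset.sum_add_distrib, Finset.sum_congr rfl fun i _ => h2 i,
    ← Finset.mul_sum, sq]

/-- The splitting of `qform` along the constant vectors and their orthogonal complement
in the `x`-coordinates. -/
theorem mul_qform_eq (d r : ℕ) (l1 l2 : ℝ) (v : Fin (d - r) ⊕ Fin r → ℝ) :
    4 * r * qform d r l1 l2 v = 4 * r * l1 * ∑ j, v (Sum.inl j) ^ 2 +
      (2 * l2 + l1) * (r * ∑ i, v (Sum.inr i) ^ 2 - (∑ i, v (Sum.inr i)) ^ 2) +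
      (2 * l2 * (r + 1) - l1 * (r - 1)) * (∑ i, v (Sum.inr i)) ^ 2 := by
  have h := two_mul_sum_sum_Ioi_mul_add_sum_sq (fun i => v (Sum.inr i))
  simp only [qform] at h ⊢
  linear_combination (2 * r * (l2 - l1 / 2)) * h

theorem qform_pos_iff (d r : ℕ) (hr : 1 ≤ r) (hrd : r < d) (l1 l2 : ℝ) :
    (∀ v : Fin (d - r) ⊕ Fin r → ℝ, v ≠ 0 → 0 < qform d r l1 l2 v) ↔
      0 < l1 ∧ l1 * ((r : ℝ) - 1) / (2 * ((r : ℝ) + 1)) < l2 := by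
  have hr1 : (1 : ℝ) ≤ r := by exact_mod_cast hr
  have hcond : l1 * ((r : ℝ) - 1) / (2 * ((r : ℝ) + 1)) < l2 ↔
      0 < 2 * l2 * (r + 1) - l1 * (r - 1) := by
    rw [div_lt_iff₀ (by positivity), ← sub_pos]
    ring_nf
  rw [hcond]
  constructor
  · intro h
    constructor
    · let j₀ : Fin (d - r) := ⟨0, by omega⟩
      have := h (Pi.single (Sum.inl j₀) 1) (by simp)
      simpa [qform, Pi.single_apply] using this
    · have := h (Sum.elim 0 1) fun h0 => by
        simpa using congrFun h0 (Sum.inr ⟨0, hr⟩)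
      have h4 : 0 < 4 * r * qform d r l1 l2 (Sum.elim 0 1) := by positivity
      rw [mul_qform_eq] at h4
      simp only [Sum.elim_inl, Sum.elim_inr, Pi.zero_apply, Pi.one_apply, one_pow,
        Finset.sum_const, Finset.card_univ, Fintype.card_fin, nsmul_eq_mul, mul_one] at h4
      have h5 : 0 < (2 * l2 * (r + 1) - l1 * (r - 1)) * (r : ℝ) ^ 2 := by
        convert h4 using 1
        ring
      exact pos_of_mul_pos_left h5 (by positivity)
  · rintro ⟨h1, h2⟩ v hv
    have hl2 : 0 < 2 * l2 + l1 := by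
      have : 0 < (2 * l2 + l1) * (r + 1) := by nlinarith
      exact pos_of_mul_pos_left this (by positivity)
    have hU : 0 ≤ ∑ j, v (Sum.inl j) ^ 2 := Finset.sum_nonneg fun _ _ => sq_nonneg _
    have hQ : 0 ≤ ∑ i, v (Sum.inr i) ^ 2 := Finset.sum_nonneg fun _ _ => sq_nonneg _
    have hS : 0 ≤ r * ∑ i, v (Sum.inr i) ^ 2 - (∑ i, v (Sum.inr i)) ^ 2 := by
      simpa using sq_sum_le_card_mul_sum_sq (s := Finset.univ) (f := fun i => v (Sum.inr i))
    suffices 0 < 4 * r * qform d r l1 l2 v from pos_of_mul_pos_right this (by positivity)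
    rw [mul_qform_eq]
    rcases hU.lt_or_eq with hU' | hU'
    · positivity
    rcases hS.lt_or_eq with hS' | hS'
    · positivity
    rcases (sq_nonneg (∑ i, v (Sum.inr i))).lt_or_eq with hT' | hT'
    · positivity
    refine absurd ?_ hv
    have hQ' : ∑ i, v (Sum.inr i) ^ 2 = 0 := by
      rw [← hT', sub_zero] at hS'
      exact (mul_eq_zero.mp hS'.symm).resolve_left (by positivity)
    rw [eq_comm, Finset.sum_eq_zero_iff_of_nonneg fun _ _ => sq_nonneg _] at hU'
    rw [Finset.sum_eq_zero_iff_of_nonneg fun _ _ => sq_nonneg _] at hQ'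
    ext (j | i)
    · simpa using hU' j (Finset.mem_univ j)
    · simpa using hQ' i (Finset.mem_univ i)

/-- `B` is positive definite iff for every `γ ∈ {a,b,c}`, `λ₁ᵞ > 0` and
`λ₂ᵞ > λ₁ᵞ(r−1)/(2(r+1))`. -/
theorem stmt17 (d r : ℕ) (hr : 1 ≤ r) (hrd : r < d) (l1 l2 : Fin 3 → ℝ) :
    (∀ v : Fin 3 → (Fin (d - r) ⊕ Fin r → ℝ), v ≠ 0 → 0 < Bform d r l1 l2 v) ↔
      (∀ γ : Fin 3, 0 < l1 γ ∧ l1 γ * ((r : ℝ) - 1) / (2 * ((r : ℝ) + 1)) < l2 γ) := by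
  have hzero : ∀ γ, qform d r (l1 γ) (l2 γ) 0 = 0 := by simp [qform]
  simp_rw [← qform_pos_iff d r hr hrd]
  constructor
  · intro h γ v hv
    have := h (Pi.single γ v) (by simpa using hv)
    rwa [Bform, Finset.sum_eq_single γ (fun b _ hb => by rw [Pi.single_eq_of_ne hb, hzero])
      (by simp), Pi.single_eq_same] at this
  · intro h v hv
    obtain ⟨γ, hγ⟩ := Function.ne_iff.mp hv
    refine Finset.sum_pos' (fun b _ => ?_) ⟨γ, Finset.mem_univ γ, h γ _ hγ⟩
    by_cases hb : v b = 0
    · rw [hb, hzero]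
    · exact (h b _ hb).le
end
end
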